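/- Let n be a positive integer with prime decomposition n = p₁^{r₁} ⋯ p_t^{r_t}, let d be a positive integer and b ∈ ℤ^d. Then λ_b = Σ_{x ∈ {0,...,n-1}^d, gcd(x·x, n)=1} e_n(b·x) equals δ(n|b)·n^d + Σ_{∅ ≠ I ⊆ {1,...,t}} ((−1)^{|I|}/p_I) · δ(n_I|b) · n_I^d · f_{p_I}(b/n_I), where for nonempty I, p_I = Π_{i∈I} p_i, n_I = n/p_I, δ(m|b) is 1 if m divides every coordinate of b and 0 otherwise, and b/n_I denotes coordinatewise division (only needed when δ(n_I|b) = 1). -/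

import Mathlib

open Finset

/-- `en n x = exp(2πi x / n)` -/
noncomputable def en (n : ℕ) (x : ℤ) : ℂ := Complex.exp (2 * Real.pi * Complex.I * x / n)

/-- The eigenvalue `λ_b = Σ_{x ∈ {0,…,n-1}^d, gcd(x·x, n) = 1} e_n(b·x)`. -/
noncomputable def lamb (n d : ℕ) (b : Fin d → ℤ) : ℂ :=
  ∑ x ∈ (Fintype.piFinset fun _ : Fin d => Finset.Ico (0:ℤ) n) |>.filter
      (fun x => Int.gcd (∑ i, x i ^ 2) n = 1),
    en n (∑ i, b i * x i)

/-- `f_n(b) = Σ_{k=0}^{n-1} Σ_{x ∈ {0,…,n-1}^d} e_n(b·x + k(x·x))`. -/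
noncomputable def fsum (n d : ℕ) (b : Fin d → ℤ) : ℂ :=
  ∑ k ∈ Finset.range n, ∑ x ∈ Fintype.piFinset fun _ : Fin d => Finset.Ico (0:ℤ) n,
    en n (∑ i, b i * x i + k * ∑ i, x i ^ 2)

lemma en_add (n : ℕ) (x y : ℤ) : en n (x + y) = en n x * en n y := by
  simp only [en, ← Complex.exp_add]
  congr 1
  push_cast
  ring

lemma en_zero (n : ℕ) : en n 0 = 1 := by simp [en]

lemma en_sum {ι : Type*} (n : ℕ) (s : Finset ι) (f : ι → ℤ) :
    en n (∑ i ∈ s, f i) = ∏ i ∈ s, en n (f i) := by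
  classical
  induction s using Finset.induction_on with
  | empty => simp [en_zero]
  | insert a s ha ih => rw [Finset.sum_insert ha, Finset.prod_insert ha, en_add, ih]

lemma en_mul_natCast (n : ℕ) (x : ℤ) (j : ℕ) : en n (x * j) = en n x ^ j := by
  simp only [en, ← Complex.exp_nat_mul]
  congr 1
  push_cast
  ring

lemma en_mul_mul_left {m : ℕ} (hm : m ≠ 0) (n : ℕ) (x : ℤ) : en (m * n) (m * x) = en n x := by
  simp only [en]
  congr 1
  have : (m : ℂ) ≠ 0 := by exact_mod_cast hm
  push_cast
  rw [show 2 * (Real.pi : ℂ) * Complex.I * (m * x) = m * (2 * Real.pi * Complex.I * x) by ring,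
    mul_div_mul_left _ _ this]

lemma en_eq_one_iff {n : ℕ} (hn : n ≠ 0) (x : ℤ) : en n x = 1 ↔ (n : ℤ) ∣ x := by
  have hn' : (n : ℂ) ≠ 0 := by exact_mod_cast hn
  have hpi : 2 * (Real.pi : ℂ) * Complex.I ≠ 0 := Complex.two_pi_I_ne_zero
  rw [en, Complex.exp_eq_one_iff]
  refine exists_congr fun k => ?_
  rw [div_eq_iff hn', show (k : ℂ) * (2 * Real.pi * Complex.I) * n
    = 2 * Real.pi * Complex.I * (n * k) by ring, mul_right_inj' hpi]
  exact_mod_cast Iff.rfl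

/-- Orthogonality of additive characters modulo `n`. -/
lemma sum_range_en_mul {n : ℕ} (hn : n ≠ 0) (b : ℤ) :
    ∑ j ∈ Finset.range n, en n (b * j) = if (n : ℤ) ∣ b then (n : ℂ) else 0 := by
  simp only [en_mul_natCast]
  split_ifs with h
  · simp [(en_eq_one_iff hn b).2 h]
  · have h1 : en n b ≠ 1 := fun h' => h ((en_eq_one_iff hn b).1 h')
    rw [geom_sum_eq h1, ← en_mul_natCast, (en_eq_one_iff hn _).2 (dvd_mul_left _ _)]
    simp

lemma sum_Ico_zero_natCast (n : ℕ) (f : ℤ → ℂ) :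
    ∑ x ∈ Finset.Ico (0 : ℤ) n, f x = ∑ j ∈ Finset.range n, f j := by
  symm
  refine Finset.sum_nbij' (fun j : ℕ => (j : ℤ)) Int.toNat ?_ ?_ ?_ ?_ ?_ <;>
    simp <;> omega

lemma sum_range_mul_eq_sum_sum (m N : ℕ) (f : ℕ → ℂ) :
    ∑ x ∈ Finset.range (m * N), f x
      = ∑ j ∈ Finset.range N, ∑ y ∈ Finset.range m, f (m * j + y) := by
  induction N with
  | zero => simp
  | succ N ih => rw [Nat.mul_succ, Finset.sum_range_add, ih, Finset.sum_range_succ]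

lemma sum_en_mul_en_sq {m N : ℕ} (hm : m ≠ 0) (hN : N ≠ 0) (b k : ℤ) :
    ∑ x ∈ Finset.Ico (0 : ℤ) (m * N : ℕ), en (m * N) (b * x) * en m (k * x ^ 2)
      = if (N : ℤ) ∣ b then
          N * ∑ y ∈ Finset.Ico (0 : ℤ) m, en m (b / N * y + k * y ^ 2) else 0 := by
  rw [sum_Ico_zero_natCast, sum_range_mul_eq_sum_sum]
  have key (j y : ℕ) : en (m * N) (b * (m * j + y : ℕ)) * en m (k * (m * j + y : ℕ) ^ 2)
      = en N (b * j) * (en (m * N) (b * y) * en m (k * y ^ 2)) := by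
    have h1 : b * (m * j + y : ℕ) = m * (b * j) + b * y := by push_cast; ring
    have h2 : k * (m * j + y : ℕ) ^ 2 = m * (k * (m * j ^ 2 + 2 * j * y)) + k * y ^ 2 := by
      push_cast; ring
    rw [h1, h2, en_add, en_add, en_mul_mul_left hm,
      (en_eq_one_iff hm (m * (k * (m * j ^ 2 + 2 * j * y)))).2 (dvd_mul_right _ _)]
    ring
  simp only [key, ← Finset.mul_sum, ← Finset.sum_mul]
  rw [sum_range_en_mul hN]
  split_ifs with h
  · obtain ⟨c, rfl⟩ := h
    rw [sum_Ico_zero_natCast, Int.mul_ediv_cancel_left _ (by exact_mod_cast hN)]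
    congr 1
    refine Finset.sum_congr rfl fun y _ => ?_
    rw [en_add, mul_comm m N, mul_assoc, en_mul_mul_left hN]
  · simp

lemma sum_piFinset_en_mul_en_sq {m N : ℕ} (hm : m ≠ 0) (hN : N ≠ 0) (d : ℕ) (b : Fin d → ℤ)
    (k : ℤ) :
    ∑ x ∈ Fintype.piFinset fun _ : Fin d => Finset.Ico (0 : ℤ) (m * N : ℕ),
        en (m * N) (∑ i, b i * x i) * en m (k * ∑ i, x i ^ 2)
      = if ∀ i, (N : ℤ) ∣ b i then
          (N : ℂ) ^ d * ∑ y ∈ Fintype.piFinset fun _ : Fin d => Finset.Ico (0 : ℤ) m,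
            en m (∑ i, b i / N * y i + k * ∑ i, y i ^ 2) else 0 := by
  simp only [Finset.mul_sum _ _ k, ← Finset.sum_add_distrib, en_sum, ← Finset.prod_mul_distrib]
  rw [Finset.sum_prod_piFinset (Finset.Ico (0 : ℤ) (m * N : ℕ))
      (fun i x => en (m * N) (b i * x) * en m (k * x ^ 2)),
    Finset.sum_prod_piFinset (Finset.Ico (0 : ℤ) m)
      (fun i y => en m (b i / N * y + k * y ^ 2))]
  simp only [sum_en_mul_en_sq hm hN, Finset.prod_ite_zero, Finset.mem_univ, true_imp_iff,
    Finset.prod_mul_distrib, Finset.prod_const, Finset.card_univ, Fintype.card_fin]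

lemma sum_piFinset_en_of_dvd {m N : ℕ} (hm : m ≠ 0) (hN : N ≠ 0) (d : ℕ) (b : Fin d → ℤ) :
    ∑ x ∈ Fintype.piFinset fun _ : Fin d => Finset.Ico (0 : ℤ) (m * N : ℕ),
        (if (m : ℤ) ∣ ∑ i, x i ^ 2 then (1 : ℂ) else 0) * en (m * N) (∑ i, b i * x i)
      = 1 / m * if ∀ i, (N : ℤ) ∣ b i then (N : ℂ) ^ d * fsum m d (fun i => b i / N) else 0 := by
  have hm' : (m : ℂ) ≠ 0 := by exact_mod_cast hm
  have hdet (s : ℤ) : (if (m : ℤ) ∣ s then (1 : ℂ) else 0)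
      = 1 / m * ∑ k ∈ Finset.range m, en m (k * s) := by
    simp only [mul_comm _ s]
    rw [sum_range_en_mul hm]
    split_ifs <;> simp [hm']
  simp only [hdet, mul_assoc, ← Finset.mul_sum]
  congr 1
  simp only [Finset.sum_mul]
  rw [Finset.sum_comm]
  simp only [mul_comm (en m _), sum_piFinset_en_mul_en_sq hm hN]
  split_ifs
  · rw [fsum, Finset.mul_sum]
  · simp

/-- Inclusion-exclusion over the prime divisors of `n` detects coprimality to `n`. -/
lemma sum_powerset_primeFactors_dvd {n : ℕ} (hn : n ≠ 0) (s : ℤ) :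
    ∑ I ∈ n.primeFactors.powerset,
        (-1 : ℂ) ^ I.card * (if ((∏ p ∈ I, p : ℕ) : ℤ) ∣ s then 1 else 0)
      = if Int.gcd s n = 1 then 1 else 0 := by
  have hterm : ∀ I ∈ n.primeFactors.powerset,
      (-1 : ℂ) ^ I.card * (if ((∏ p ∈ I, p : ℕ) : ℤ) ∣ s then 1 else 0)
        = ∏ p ∈ I, if (p : ℤ) ∣ s then (-1 : ℂ) else 0 := by
    intro I hI
    have hI' : ∀ p ∈ I, p.Prime := fun p hp =>
      Nat.prime_of_mem_primeFactors (Finset.mem_powerset.1 hI hp)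
    have hiff : ((∏ p ∈ I, p : ℕ) : ℤ) ∣ s ↔ ∀ p ∈ I, (p : ℤ) ∣ s := by
      simp only [Int.natCast_dvd]
      exact ⟨fun h p hp => (Finset.dvd_prod_of_mem _ hp).trans h,
        fun h => Finset.prod_primes_dvd _ (fun p hp => (hI' p hp).prime) h⟩
    simp only [Finset.prod_ite_zero, Finset.prod_const, hiff, mul_ite, mul_one, mul_zero]
  rw [Finset.sum_congr rfl hterm, ← Finset.prod_one_add]
  have hfac (p : ℕ) : (1 + if (p : ℤ) ∣ s then (-1 : ℂ) else 0)
      = if ¬ (p : ℤ) ∣ s then 1 else 0 := by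
    split_ifs <;> simp
  simp only [hfac, Finset.prod_ite_zero, Finset.prod_const_one]
  refine if_congr ?_ rfl rfl
  rw [Int.gcd, Int.natAbs_natCast, ← Nat.coprime_iff_gcd_eq_one, Nat.coprime_comm]
  simp only [Int.natCast_dvd, Nat.mem_primeFactors]
  refine ⟨fun h => Nat.coprime_of_dvd fun p hp hpn => h p ⟨hp, hpn, hn⟩, fun h p hp hps => ?_⟩
  exact Nat.not_coprime_of_dvd_of_dvd hp.1.one_lt hp.2.1 hps h

/-- `λ_b = δ(n∣b) n^d + Σ_{∅≠I} ((−1)^{|I|}/p_I) δ(n_I∣b) n_I^d f_{p_I}(b/n_I)`. -/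
theorem lamb_eq (n d : ℕ) (hn : 0 < n) (hd : 0 < d) (b : Fin d → ℤ) :
    lamb n d b =
      (if ∀ i, b i % (n : ℤ) = 0 then (n : ℂ) ^ d else 0) +
      ∑ I ∈ n.primeFactors.powerset.filter (· ≠ ∅),
        (let pI : ℕ := ∏ p ∈ I, p
         let nI : ℕ := n / pI
         ((-1 : ℂ) ^ I.card / (pI : ℂ)) *
           (if ∀ i, b i % (nI : ℤ) = 0 then (nI : ℂ) ^ d * fsum pI d (fun i => b i / nI)
            else 0)) := by
  have hmod (k : ℕ) (i : Fin d) : b i % (k : ℤ) = 0 ↔ (k : ℤ) ∣ b i :=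
    Int.dvd_iff_emod_eq_zero.symm
  simp only [hmod]
  have hlamb : lamb n d b = ∑ I ∈ n.primeFactors.powerset,
      ((-1 : ℂ) ^ I.card / ((∏ p ∈ I, p : ℕ) : ℂ)) *
        (if ∀ i, ((n / ∏ p ∈ I, p : ℕ) : ℤ) ∣ b i then
          ((n / ∏ p ∈ I, p : ℕ) : ℂ) ^ d *
            fsum (∏ p ∈ I, p) d (fun i => b i / (n / ∏ p ∈ I, p : ℕ)) else 0) := by
    rw [lamb, Finset.sum_filter]
    have hind (x : Fin d → ℤ) :
        (if Int.gcd (∑ i, x i ^ 2) n = 1 then en n (∑ i, b i * x i) else 0)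
          = ∑ I ∈ n.primeFactors.powerset, (-1 : ℂ) ^ I.card *
            ((if ((∏ p ∈ I, p : ℕ) : ℤ) ∣ ∑ i, x i ^ 2 then 1 else 0) *
              en n (∑ i, b i * x i)) := by
      simp only [← mul_assoc]
      rw [← Finset.sum_mul, sum_powerset_primeFactors_dvd hn.ne']
      split_ifs <;> simp
    simp only [hind]
    rw [Finset.sum_comm]
    refine Finset.sum_congr rfl fun I hI => ?_
    have hdvd : ∏ p ∈ I, p ∣ n :=
      (Finset.prod_dvd_prod_of_subset _ _ _ (Finset.mem_powerset.1 hI)).trans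
        (Nat.prod_primeFactors_dvd n)
    have hm := ne_zero_of_dvd_ne_zero hn.ne' hdvd
    have hmul : (∏ p ∈ I, p) * (n / ∏ p ∈ I, p) = n := Nat.mul_div_cancel' hdvd
    have hN : n / ∏ p ∈ I, p ≠ 0 := fun h => hn.ne' (by rw [← hmul, h, mul_zero])
    have h := sum_piFinset_en_of_dvd hm hN d b
    rw [hmul] at h
    rw [← Finset.mul_sum, h, ← mul_assoc, mul_one_div]
  have hone : fsum 1 d (fun i => b i / n) = 1 := by
    have hen (x : ℤ) : en 1 x = 1 := (en_eq_one_iff one_ne_zero x).2 (by simp)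
    simp [fsum, hen]
  rw [hlamb, Finset.filter_ne', ← Finset.add_sum_erase _ _ (Finset.empty_mem_powerset _)]
  simp [hone]
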